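/- arXiv:1603.04950 — 5 statements merged into one kernel-verified Lean document; each statement's English description precedes it below -/
import Mathlib

section
/- Let K ∈ ℂ^{2m×2m} be invertible with KΣ_m = Σ_m K^#, K J_m K† = J_m, and K K† = I_{2m}. Then, writing K = [[K₁, K₂],[K₂^#, K₁^#]] with m×m blocks, one has K₂ = 0 and K₁K₁† = I_m; that is, K = diag(S, S^#) for some unitary matrix S ∈ ℂ^{m×m}. -/
open Matrix

noncomputable section

/-- `J_k = [[I, 0],[0, −I]]`. -/
def Jmat (k : ℕ) : Matrix (Fin k ⊕ Fin k) (Fin k ⊕ Fin k) ℂ :=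
  Matrix.fromBlocks 1 0 0 (-1)

/-- `Σ_k = [[0, I],[I, 0]]`. -/
def SigmaMat (k : ℕ) : Matrix (Fin k ⊕ Fin k) (Fin k ⊕ Fin k) ℂ :=
  Matrix.fromBlocks 0 1 1 0

/-- Entrywise complex conjugate of a matrix. -/
def conjMat {α β : Type*} (R : Matrix α β ℂ) : Matrix α β ℂ :=
  R.map (starRingEnd ℂ)

/-- if `K` is invertible, doubled-up, `K J K† = J` and `K K† = I`, then writing
`K = [[K₁,K₂],[K₂^#,K₁^#]]` one has `K₂ = 0` and `K₁ K₁† = I`; that is, `K = diag(S, S^#)`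
for some unitary `S`. -/
theorem stmt1 (m : ℕ) (hm : 0 < m) (K : Matrix (Fin m ⊕ Fin m) (Fin m ⊕ Fin m) ℂ)
    (hKinv : IsUnit K)
    (hdoubled : K * SigmaMat m = SigmaMat m * conjMat K)
    (hKJK : K * Jmat m * Kᴴ = Jmat m)
    (hKK : K * Kᴴ = 1)
    (K₁ K₂ : Matrix (Fin m) (Fin m) ℂ)
    (hblocks : K = Matrix.fromBlocks K₁ K₂ (conjMat K₂) (conjMat K₁)) :
    K₂ = 0 ∧ K₁ * K₁ᴴ = 1 ∧
      ∃ S : Matrix (Fin m) (Fin m) ℂ, Sᴴ * S = 1 ∧ S * Sᴴ = 1 ∧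
        K = Matrix.fromBlocks S 0 0 (conjMat S) := by
  subst hblocks
  simp only [Jmat, fromBlocks_conjTranspose, fromBlocks_multiply, mul_one, mul_zero, add_zero,
    zero_add, mul_neg, neg_mul] at hKJK
  rw [fromBlocks_conjTranspose, fromBlocks_multiply, ← fromBlocks_one] at hKK
  obtain ⟨hJ, -, -, -⟩ := fromBlocks_inj.mp hKJK
  obtain ⟨hI, -, -, -⟩ := fromBlocks_inj.mp hKK
  have h_sum : (2 : ℂ) • (K₂ * K₂ᴴ) = 0 := by
    calc (2 : ℂ) • (K₂ * K₂ᴴ) = (K₁ * K₁ᴴ + K₂ * K₂ᴴ) - (K₁ * K₁ᴴ + -(K₂ * K₂ᴴ)) := by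
          rw [two_smul]; abel
      _ = 0 := by rw [hI, hJ, sub_self]
  have h_zero : K₂ = 0 := by
    open scoped ComplexOrder in
    exact self_mul_conjTranspose_eq_zero.mp ((smul_eq_zero.mp h_sum).resolve_left two_ne_zero)
  subst h_zero
  have h_unitary : K₁ * K₁ᴴ = 1 := by simpa using hI
  refine ⟨rfl, h_unitary, K₁, mul_eq_one_comm.mp h_unitary, h_unitary, ?_⟩
  congr 1
  ext i j
  simp [conjMat]
end
end

section
/- A quadruple of doubled-up matrices F ∈ ℂ^{2n×2n}, G ∈ ℂ^{2n×2m}, H ∈ ℂ^{2m×2n}, K ∈ ℂ^{2m×2m} is physically realizable if and only if there exists an invertible doubled-up matrix T ∈ ℂ^{2n×2n} such that the Hermitian matrix Θ := T J_n T† satisfies: (1) FΘ + ΘF† + G J_m G† = 0; (2) G = −Θ H† J_m K; (3) K J_m K† = J_m; and (4) K K† = I_{2m}. -/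
open Matrix

noncomputable section

/-- `R ∈ ℂ^{2n×2m}` is doubled-up if `R Σ_m = Σ_n R^#`. -/
def DoubledUp {n m : ℕ} (R : Matrix (Fin n ⊕ Fin n) (Fin m ⊕ Fin m) ℂ) : Prop :=
  R * SigmaMat m = SigmaMat n * conjMat R

/-- Physical realizability of the QSDE matrices `(F, G, H, K)`: there exist an invertible
doubled-up `T`, a Hermitian doubled-up `M`, a doubled-up `N` and `S` with `S†S = I` such that,
with `Θ := T J_n T†`: `F = −iΘM − (1/2)Θ N† J_m N`, `G = −Θ N† diag(S, −S^#)`, `H = N`,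
`K = diag(S, S^#)`. -/
def PhysicallyRealizable {n m : ℕ}
    (F : Matrix (Fin n ⊕ Fin n) (Fin n ⊕ Fin n) ℂ)
    (G : Matrix (Fin n ⊕ Fin n) (Fin m ⊕ Fin m) ℂ)
    (H : Matrix (Fin m ⊕ Fin m) (Fin n ⊕ Fin n) ℂ)
    (K : Matrix (Fin m ⊕ Fin m) (Fin m ⊕ Fin m) ℂ) : Prop :=
  ∃ (T M : Matrix (Fin n ⊕ Fin n) (Fin n ⊕ Fin n) ℂ)
    (N : Matrix (Fin m ⊕ Fin m) (Fin n ⊕ Fin n) ℂ)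
    (S : Matrix (Fin m) (Fin m) ℂ),
      IsUnit T ∧ DoubledUp T ∧ Mᴴ = M ∧ DoubledUp M ∧ DoubledUp N ∧ Sᴴ * S = 1 ∧
      F = -(Complex.I • ((T * Jmat n * Tᴴ) * M)) -
            (1 / 2 : ℂ) • ((T * Jmat n * Tᴴ) * Nᴴ * Jmat m * N) ∧
      G = -((T * Jmat n * Tᴴ) * Nᴴ * Matrix.fromBlocks S 0 0 (-(conjMat S))) ∧
      H = N ∧
      K = Matrix.fromBlocks S 0 0 (conjMat S)

/-- `R Σ_m = c Σ_n R^#`; the doubled-up matrices are the case `c = 1`. -/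
def ScaledDoubledUp {n m : ℕ} (c : ℂ) (R : Matrix (Fin n ⊕ Fin n) (Fin m ⊕ Fin m) ℂ) : Prop :=
  R * SigmaMat m = c • (SigmaMat n * conjMat R)

lemma conjMat_mul {α β γ : Type*} [Fintype β] (A : Matrix α β ℂ) (B : Matrix β γ ℂ) :
    conjMat (A * B) = conjMat A * conjMat B :=
  Matrix.map_mul

lemma conjMat_add {α β : Type*} (A B : Matrix α β ℂ) :
    conjMat (A + B) = conjMat A + conjMat B := by
  ext; simp [conjMat]

lemma conjMat_smul {α β : Type*} (a : ℂ) (A : Matrix α β ℂ) :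
    conjMat (a • A) = starRingEnd ℂ a • conjMat A := by
  ext; simp [conjMat]

lemma conjMat_one {α : Type*} [DecidableEq α] : conjMat (1 : Matrix α α ℂ) = 1 :=
  Matrix.map_one _ (map_zero _) (map_one _)

lemma conjMat_conjTranspose {α β : Type*} (A : Matrix α β ℂ) : conjMat Aᴴ = Aᵀ := by
  ext; simp [conjMat]

lemma conjTranspose_conjMat {α β : Type*} (A : Matrix α β ℂ) : (conjMat A)ᴴ = Aᵀ := by
  ext; simp [conjMat]

lemma SigmaMat_mul_self (k : ℕ) : SigmaMat k * SigmaMat k = 1 := by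
  simp [SigmaMat, fromBlocks_multiply]

lemma conjTranspose_SigmaMat (k : ℕ) : (SigmaMat k)ᴴ = SigmaMat k := by
  simp [SigmaMat, fromBlocks_conjTranspose]

lemma Jmat_mul_self (k : ℕ) : Jmat k * Jmat k = 1 := by
  simp [Jmat, fromBlocks_multiply]

lemma conjTranspose_Jmat (k : ℕ) : (Jmat k)ᴴ = Jmat k := by
  simp [Jmat, fromBlocks_conjTranspose]

lemma conjMat_Jmat (k : ℕ) : conjMat (Jmat k) = Jmat k := by
  rw [← conjTranspose_Jmat, conjMat_conjTranspose]
  simp [Jmat, fromBlocks_transpose, fromBlocks_conjTranspose]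

lemma Jmat_scaledDoubledUp (k : ℕ) : ScaledDoubledUp (-1) (Jmat k) := by
  rw [ScaledDoubledUp, conjMat_Jmat]
  simp [Jmat, SigmaMat, fromBlocks_multiply, fromBlocks_neg]

lemma DoubledUp.scaled {n m : ℕ} {R : Matrix (Fin n ⊕ Fin n) (Fin m ⊕ Fin m) ℂ}
    (h : DoubledUp R) : ScaledDoubledUp 1 R := by
  rw [ScaledDoubledUp, one_smul]
  exact h

namespace ScaledDoubledUp

lemma mul {n m l : ℕ} {c d : ℂ} {A : Matrix (Fin n ⊕ Fin n) (Fin m ⊕ Fin m) ℂ}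
    {B : Matrix (Fin m ⊕ Fin m) (Fin l ⊕ Fin l) ℂ}
    (hA : ScaledDoubledUp c A) (hB : ScaledDoubledUp d B) : ScaledDoubledUp (c * d) (A * B) := by
  unfold ScaledDoubledUp at *
  rw [Matrix.mul_assoc, hB, Matrix.mul_smul, ← Matrix.mul_assoc, hA, Matrix.smul_mul, smul_smul,
    Matrix.mul_assoc, ← conjMat_mul, mul_comm]

lemma add {n m : ℕ} {c : ℂ} {A B : Matrix (Fin n ⊕ Fin n) (Fin m ⊕ Fin m) ℂ}
    (hA : ScaledDoubledUp c A) (hB : ScaledDoubledUp c B) : ScaledDoubledUp c (A + B) := by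
  unfold ScaledDoubledUp at *
  rw [Matrix.add_mul, hA, hB, conjMat_add, Matrix.mul_add, smul_add]

lemma smul {n m : ℕ} {a b c : ℂ} {A : Matrix (Fin n ⊕ Fin n) (Fin m ⊕ Fin m) ℂ}
    (hA : ScaledDoubledUp c A) (hab : a * c = b * starRingEnd ℂ a) :
    ScaledDoubledUp b (a • A) := by
  unfold ScaledDoubledUp at *
  rw [Matrix.smul_mul, hA, conjMat_smul, Matrix.mul_smul, smul_smul, smul_smul, hab]

lemma conjTranspose {n m : ℕ} {A : Matrix (Fin n ⊕ Fin n) (Fin m ⊕ Fin m) ℂ}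
    (hA : ScaledDoubledUp 1 A) : ScaledDoubledUp 1 Aᴴ := by
  unfold ScaledDoubledUp at *
  rw [one_smul] at *
  have h := congrArg Matrix.conjTranspose hA
  rw [conjTranspose_mul, conjTranspose_mul, conjTranspose_SigmaMat, conjTranspose_SigmaMat,
    conjTranspose_conjMat] at h
  calc Aᴴ * SigmaMat n = SigmaMat m * (SigmaMat m * Aᴴ) * SigmaMat n := by
        rw [← Matrix.mul_assoc, SigmaMat_mul_self, Matrix.one_mul]
    _ = SigmaMat m * conjMat Aᴴ := by
        rw [h, conjMat_conjTranspose, Matrix.mul_assoc, Matrix.mul_assoc, SigmaMat_mul_self,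
          Matrix.mul_one]

lemma of_inverse {n : ℕ} {A B : Matrix (Fin n ⊕ Fin n) (Fin n ⊕ Fin n) ℂ}
    (hA : ScaledDoubledUp (-1) A) (hBA : B * A = 1) : ScaledDoubledUp (-1) B := by
  unfold ScaledDoubledUp at *
  have hAB : conjMat A * conjMat B = 1 := by
    rw [← conjMat_mul, mul_eq_one_comm.mp hBA, conjMat_one]
  have h := congrArg (fun X => B * X * conjMat B) hA
  simp only [Matrix.mul_smul, Matrix.smul_mul] at h
  rw [← Matrix.mul_assoc, hBA, Matrix.one_mul, Matrix.mul_assoc B, Matrix.mul_assoc, hAB,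
    Matrix.mul_one] at h
  rw [h, smul_smul]
  simp

end ScaledDoubledUp

/-- A doubled-up unitary matrix preserving `J` is `diag(S, S^#)` with `S` unitary. -/
lemma exists_eq_fromBlocks_of_unitary {m : ℕ} {K : Matrix (Fin m ⊕ Fin m) (Fin m ⊕ Fin m) ℂ}
    (hK : DoubledUp K) (hJ : K * Jmat m * Kᴴ = Jmat m) (hU : K * Kᴴ = 1) :
    ∃ S : Matrix (Fin m) (Fin m) ℂ, Sᴴ * S = 1 ∧ K = fromBlocks S 0 0 (conjMat S) := by
  have hU' : Kᴴ * K = 1 := mul_eq_one_comm.mp hU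
  have hcomm : K * Jmat m = Jmat m * K := by
    rw [← hJ, Matrix.mul_assoc (K * Jmat m), hU', Matrix.mul_one, hJ]
  obtain ⟨A, B, C, D, rfl⟩ : ∃ A B C D, K = fromBlocks A B C D :=
    ⟨_, _, _, _, (fromBlocks_toBlocks K).symm⟩
  simp only [Jmat, fromBlocks_multiply, Matrix.mul_zero, Matrix.mul_one, Matrix.mul_neg,
    Matrix.zero_mul, Matrix.one_mul, Matrix.neg_mul, add_zero, zero_add, fromBlocks_inj] at hcomm
  obtain ⟨-, hB, hC, -⟩ := hcomm
  obtain rfl : B = 0 := by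
    ext i j
    exact neg_eq_self.mp (congrFun (congrFun hB i) j)
  obtain rfl : C = 0 := by
    ext i j
    exact self_eq_neg.mp (congrFun (congrFun hC i) j)
  simp only [DoubledUp, SigmaMat, conjMat, fromBlocks_map, fromBlocks_multiply, Matrix.mul_zero,
    Matrix.mul_one, Matrix.zero_mul, Matrix.one_mul, add_zero, zero_add, fromBlocks_inj] at hK
  refine ⟨A, ?_, ?_⟩
  · simp only [fromBlocks_conjTranspose, fromBlocks_multiply, ← fromBlocks_one,
      fromBlocks_inj, conjTranspose_zero, Matrix.mul_zero, add_zero] at hU'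
    exact hU'.1
  · rw [hK.2.2.1]
    rfl

/-- `(F,G,H,K)` is physically realizable iff there is an invertible doubled-up
`T` such that `Θ := T J_n T†` satisfies the four physical realizability equations. -/
theorem stmt2 (n m : ℕ) (hn : 0 < n) (hm : 0 < m)
    (F : Matrix (Fin n ⊕ Fin n) (Fin n ⊕ Fin n) ℂ)
    (G : Matrix (Fin n ⊕ Fin n) (Fin m ⊕ Fin m) ℂ)
    (H : Matrix (Fin m ⊕ Fin m) (Fin n ⊕ Fin n) ℂ)
    (K : Matrix (Fin m ⊕ Fin m) (Fin m ⊕ Fin m) ℂ)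
    (hF : DoubledUp F) (hG : DoubledUp G) (hH : DoubledUp H) (hK : DoubledUp K) :
    PhysicallyRealizable F G H K ↔
      ∃ T : Matrix (Fin n ⊕ Fin n) (Fin n ⊕ Fin n) ℂ, IsUnit T ∧ DoubledUp T ∧
        F * (T * Jmat n * Tᴴ) + (T * Jmat n * Tᴴ) * Fᴴ + G * Jmat m * Gᴴ = 0 ∧
        G = -((T * Jmat n * Tᴴ) * Hᴴ * Jmat m * K) ∧
        K * Jmat m * Kᴴ = Jmat m ∧
        K * Kᴴ = 1 := by
  have hJJ := Jmat_mul_self m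
  have hΘ : ∀ T : Matrix (Fin n ⊕ Fin n) (Fin n ⊕ Fin n) ℂ,
      (T * Jmat n * Tᴴ)ᴴ = T * Jmat n * Tᴴ := fun T => by
    simp only [conjTranspose_mul, conjTranspose_conjTranspose, conjTranspose_Jmat,
      Matrix.mul_assoc]
  have hJK : ∀ S : Matrix (Fin m) (Fin m) ℂ,
      Jmat m * fromBlocks S 0 0 (conjMat S) = fromBlocks S 0 0 (-(conjMat S)) := fun S => by
    simp [Jmat, fromBlocks_multiply]
  have hGJG : ∀ Θ : Matrix (Fin n ⊕ Fin n) (Fin n ⊕ Fin n) ℂ, Θᴴ = Θ →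
      K * Jmat m * Kᴴ = Jmat m → G = -(Θ * Hᴴ * Jmat m * K) →
      G * Jmat m * Gᴴ = Θ * Hᴴ * Jmat m * H * Θ := fun Θ hs hKJ hG => by
    calc G * Jmat m * Gᴴ = Θ * Hᴴ * Jmat m * (K * Jmat m * Kᴴ) * Jmat m * H * Θ := by
          simp only [hG, conjTranspose_neg, conjTranspose_mul, conjTranspose_conjTranspose,
            conjTranspose_Jmat, hs, Matrix.neg_mul, Matrix.mul_neg, neg_neg, Matrix.mul_assoc]
      _ = _ := by
          rw [hKJ, Matrix.mul_assoc (Θ * Hᴴ), hJJ, Matrix.mul_one]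
  constructor
  · rintro ⟨T, M, N, S, hT, hTd, hM, -, -, hS, rfl, hG', rfl, hK'⟩
    have hΘT := hΘ T
    set Θ := T * Jmat n * Tᴴ with hΘdef
    have hS' : S * Sᴴ = 1 := mul_eq_one_comm.mp hS
    have hSc : conjMat S * (conjMat S)ᴴ = 1 := by
      rw [conjTranspose_conjMat, ← conjMat_conjTranspose, ← conjMat_mul, hS', conjMat_one]
    have hKJ : K * Jmat m * Kᴴ = Jmat m := by
      rw [hK']
      simp [Jmat, fromBlocks_multiply, fromBlocks_conjTranspose, hS', hSc]
    have hGK : G = -(Θ * Hᴴ * Jmat m * K) := by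
      rw [hG', hK', Matrix.mul_assoc _ (Jmat m), hJK]
    refine ⟨T, hT, hTd, ?_, hGK, hKJ, ?_⟩
    · rw [← hΘdef, hGJG Θ hΘT hKJ hGK]
      simp only [conjTranspose_sub, conjTranspose_neg, conjTranspose_smul, conjTranspose_mul,
        conjTranspose_conjTranspose, conjTranspose_Jmat, hΘT, hM, Matrix.sub_mul, Matrix.mul_sub,
        Matrix.neg_mul, Matrix.mul_neg, Matrix.smul_mul, Matrix.mul_smul, Matrix.mul_assoc]
      simp only [one_div, star_inv₀, RCLike.star_def, Complex.conj_I, Complex.conj_ofNat]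
      module
    · rw [hK', fromBlocks_conjTranspose, fromBlocks_multiply]
      simp [hS', hSc]
  · rintro ⟨T, hT, hTd, hFΘ, hGK, hKJ, hKK⟩
    have hΘT := hΘ T
    have hΘs : ScaledDoubledUp (-1) (T * Jmat n * Tᴴ) := by
      simpa using (hTd.scaled.mul (Jmat_scaledDoubledUp n)).mul hTd.scaled.conjTranspose
    have hΘu : IsUnit (T * Jmat n * Tᴴ) :=
      (hT.mul (.of_mul_eq_one _ (Jmat_mul_self n))).mul hT.star
    obtain ⟨S, hS, hKS⟩ := exists_eq_fromBlocks_of_unitary hK hKJ hKK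
    obtain ⟨P, hP⟩ := hΘu.exists_right_inv
    rw [hGJG _ hΘT hKJ hGK] at hFΘ
    refine ⟨T, Complex.I • (P * F + (1 / 2 : ℂ) • (Hᴴ * Jmat m * H)), H, S, hT, hTd, ?_, ?_, hH,
      hS, ?_, ?_, rfl, hKS⟩
    · set Θ := T * Jmat n * Tᴴ
      have hP' : P * Θ = 1 := mul_eq_one_comm.mp hP
      have hPs : Pᴴ = P := by
        have h : Pᴴ * Θ = 1 := by
          rw [← hΘT, ← conjTranspose_mul, hP, conjTranspose_one]
        exact left_inv_eq_right_inv h hP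
      have hPF : P * F + Fᴴ * P + Hᴴ * Jmat m * H = 0 := by
        calc P * F + Fᴴ * P + Hᴴ * Jmat m * H
            = P * F * (Θ * P) + (P * Θ) * Fᴴ * P + (P * Θ) * Hᴴ * Jmat m * H * (Θ * P) := by
              simp only [hP, hP', Matrix.one_mul, Matrix.mul_one]
          _ = P * (F * Θ + Θ * Fᴴ + Θ * Hᴴ * Jmat m * H * Θ) * P := by
              simp only [Matrix.mul_add, Matrix.add_mul, Matrix.mul_assoc]
          _ = 0 := by rw [hFΘ, Matrix.mul_zero, Matrix.zero_mul]
      have hFP : Fᴴ * P = -(P * F) - Hᴴ * (Jmat m * H) := by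
        rw [← Matrix.mul_assoc, eq_sub_iff_add_eq, eq_neg_iff_add_eq_zero, ← hPF]
        abel
      simp only [conjTranspose_add, conjTranspose_smul, conjTranspose_mul, hPs,
        conjTranspose_conjTranspose, conjTranspose_Jmat, Matrix.mul_assoc, hFP]
      simp only [one_div, star_inv₀, RCLike.star_def, Complex.conj_I, Complex.conj_ofNat]
      module
    · have hPd := hΘs.of_inverse (mul_eq_one_comm.mp hP)
      have h₁ : ScaledDoubledUp (-1) (P * F) := by simpa using hPd.mul hF.scaled
      have h₂ : ScaledDoubledUp (-1) (Hᴴ * Jmat m * H) := by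
        simpa using (hH.scaled.conjTranspose.mul (Jmat_scaledDoubledUp m)).mul hH.scaled
      have h₃ : ScaledDoubledUp 1 (Complex.I • (P * F + (1 / 2 : ℂ) • (Hᴴ * Jmat m * H))) :=
        (h₁.add (h₂.smul (by simp [Complex.conj_ofNat]))).smul (by simp)
      rwa [ScaledDoubledUp, one_smul] at h₃
    · simp only [Matrix.mul_smul, Matrix.mul_add, smul_smul, Complex.I_mul_I,
        ← Matrix.mul_assoc, hP, Matrix.one_mul]
      module
    · rw [← hJK, ← hKS, ← Matrix.mul_assoc]
      exact hGK
end
end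

section
/- Matrices F ∈ ℂ^{n×n}, G ∈ ℂ^{n×m}, H ∈ ℂ^{m×n}, K ∈ ℂ^{m×m} are physically realizable in the annihilation-operator sense if and only if there exists a Hermitian positive-definite matrix Θ₁ ∈ ℂ^{n×n} such that: (1) FΘ₁ + Θ₁F† + GG† = 0; (2) G = −Θ₁H†K; and (3) K†K = I_m. -/
open Matrix
open scoped ComplexOrder

noncomputable section

/-- Physical realizability in the annihilation-operator sense: there exist a Hermitian
positive-definite `Θ₁`, a Hermitian `M₁`, a matrix `N₁`, and `S` with `S†S = I` such that
`F = −iΘ₁M₁ − (1/2)Θ₁N₁†N₁`, `G = −Θ₁N₁†S`, `H = N₁` and `K = S`. -/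
def PhysRealAnn {N M : Type*} [Fintype N] [Fintype M] [DecidableEq N] [DecidableEq M]
    (F : Matrix N N ℂ) (G : Matrix N M ℂ) (H : Matrix M N ℂ) (K : Matrix M M ℂ) : Prop :=
  ∃ (Θ₁ M₁ : Matrix N N ℂ) (N₁ : Matrix M N ℂ) (S : Matrix M M ℂ),
    Θ₁.PosDef ∧ M₁ᴴ = M₁ ∧ Sᴴ * S = 1 ∧
    F = -(Complex.I • (Θ₁ * M₁)) - (1 / 2 : ℂ) • (Θ₁ * N₁ᴴ * N₁) ∧
    G = -(Θ₁ * N₁ᴴ * S) ∧ H = N₁ ∧ K = S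

/-- A square complex matrix is Hurwitz if every element of its spectrum has negative
real part. -/
def IsHurwitz {N : Type*} [Fintype N] [DecidableEq N] (F : Matrix N N ℂ) : Prop :=
  ∀ μ ∈ spectrum ℂ F, μ.re < 0

/-- The transfer function `Γ(s) = H (sI − F)⁻¹ G + K`. -/
def transferFn {N M P : Type*} [Fintype N] [DecidableEq N]
    (F : Matrix N N ℂ) (G : Matrix N M ℂ) (H : Matrix P N ℂ) (K : Matrix P M ℂ)
    (s : ℂ) : Matrix P M ℂ :=
  H * (s • (1 : Matrix N N ℂ) - F)⁻¹ * G + K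

/-- The transfer function is lossless bounded real if `F` is Hurwitz and
`Γ(iω)† Γ(iω) = I` for all real `ω`. -/
def LosslessBoundedReal {N M : Type*} [Fintype N] [Fintype M] [DecidableEq N] [DecidableEq M]
    (F : Matrix N N ℂ) (G : Matrix N M ℂ) (H : Matrix M N ℂ) (K : Matrix M M ℂ) : Prop :=
  IsHurwitz F ∧
    ∀ ω : ℝ, (transferFn F G H K ((ω : ℂ) * Complex.I))ᴴ *
      transferFn F G H K ((ω : ℂ) * Complex.I) = 1

/-- The horizontally concatenated controllability matrix `[G, FG, …, F^{k−1}G]`. -/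
def ctrbMat {N M : Type*} [Fintype N] [DecidableEq N]
    (F : Matrix N N ℂ) (G : Matrix N M ℂ) (k : ℕ) : Matrix N (Fin k × M) ℂ :=
  Matrix.of fun i p => (F ^ (p.1 : ℕ) * G) i p.2

/-- The vertically concatenated observability matrix `[H; HF; …; HF^{k−1}]`. -/
def obsvMat {N M : Type*} [Fintype N] [DecidableEq N]
    (F : Matrix N N ℂ) (H : Matrix M N ℂ) (k : ℕ) : Matrix (Fin k × M) N ℂ :=
  Matrix.of fun p j => (H * F ^ (p.1 : ℕ)) p.2 j

/-- With `G = −ΘH†K`, `K†K = I` and `Θ` Hermitian, `GG† = ΘH†HΘ`. -/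
theorem coupling_mul_conjTranspose {N M : Type*} [Fintype N] [Fintype M] [DecidableEq M]
    {Θ : Matrix N N ℂ} {G : Matrix N M ℂ} {H : Matrix M N ℂ} {K : Matrix M M ℂ}
    (hΘ : Θᴴ = Θ) (hG : G = -(Θ * Hᴴ * K)) (hK : Kᴴ * K = 1) :
    G * Gᴴ = Θ * Hᴴ * H * Θ := by
  have hK' : K * Kᴴ = 1 := mul_eq_one_comm.mp hK
  calc G * Gᴴ = Θ * Hᴴ * (K * Kᴴ) * H * Θ := by
        simp only [hG, conjTranspose_neg, conjTranspose_mul, conjTranspose_conjTranspose, hΘ,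
          Matrix.neg_mul, Matrix.mul_neg, neg_neg, Matrix.mul_assoc]
    _ = Θ * Hᴴ * H * Θ := by rw [hK', Matrix.mul_one]

/-- `(F,G,H,K)` is physically realizable in the annihilation-operator sense iff
there is a Hermitian positive-definite `Θ₁` with `FΘ₁ + Θ₁F† + GG† = 0`, `G = −Θ₁H†K` and
`K†K = I`. -/
theorem stmt7 (n m : ℕ) (hn : 0 < n) (hm : 0 < m)
    (F : Matrix (Fin n) (Fin n) ℂ) (G : Matrix (Fin n) (Fin m) ℂ)
    (H : Matrix (Fin m) (Fin n) ℂ) (K : Matrix (Fin m) (Fin m) ℂ) :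
    PhysRealAnn F G H K ↔
      ∃ Θ₁ : Matrix (Fin n) (Fin n) ℂ, Θ₁.PosDef ∧
        F * Θ₁ + Θ₁ * Fᴴ + G * Gᴴ = 0 ∧
        G = -(Θ₁ * Hᴴ * K) ∧
        Kᴴ * K = 1 := by
  constructor
  · rintro ⟨Θ, P, L, S, hΘ, hP, hS, hF, hG, rfl, rfl⟩
    have hΘ' : Θᴴ = Θ := hΘ.isHermitian.eq
    refine ⟨Θ, hΘ, ?_, hG, hS⟩
    rw [coupling_mul_conjTranspose hΘ' hG hS, hF]
    simp only [conjTranspose_sub, conjTranspose_neg, conjTranspose_smul, conjTranspose_mul,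
      conjTranspose_conjTranspose, hΘ', hP, Matrix.sub_mul, Matrix.mul_sub, Matrix.neg_mul,
      Matrix.mul_neg, Matrix.smul_mul, Matrix.mul_smul, Matrix.mul_assoc, Complex.star_def,
      Complex.conj_I, map_div₀, map_one, map_ofNat]
    module
  · rintro ⟨Θ, hΘ, hLyap, hG, hK⟩
    have hΘ' : Θᴴ = Θ := hΘ.isHermitian.eq
    have hdet : IsUnit Θ.det := (Matrix.isUnit_iff_isUnit_det Θ).mp hΘ.isUnit
    have hinv : Θ * Θ⁻¹ = 1 := Matrix.mul_nonsing_inv Θ hdet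
    refine ⟨Θ, (Complex.I / 2) • (Θ⁻¹ * F - Fᴴ * Θ⁻¹), H, K, hΘ, ?_, hK, ?_, hG, rfl, rfl⟩
    · simp only [conjTranspose_smul, conjTranspose_sub, conjTranspose_mul,
        conjTranspose_conjTranspose, conjTranspose_nonsing_inv, hΘ', Complex.star_def,
        map_div₀, Complex.conj_I, map_ofNat]
      module
    · rw [coupling_mul_conjTranspose hΘ' hG hK] at hLyap
      have hF : F + Θ * Fᴴ * Θ⁻¹ + Θ * Hᴴ * H = 0 := by
        simpa only [Matrix.add_mul, Matrix.mul_assoc, hinv, Matrix.mul_one, Matrix.zero_mul]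
          using congrArg (· * Θ⁻¹) hLyap
      have hI : Complex.I * (Complex.I / 2) = -(1 / 2) := by
        rw [← mul_div_assoc, Complex.I_mul_I]; ring
      rw [Matrix.mul_smul, smul_smul, hI, Matrix.mul_sub, ← Matrix.mul_assoc, hinv,
        Matrix.one_mul, ← Matrix.mul_assoc]
      linear_combination (norm := module) (1 / 2 : ℂ) • hF
end
end

section
/- (Complex lossless bounded real lemma.) Suppose F ∈ ℂ^{n×n}, G ∈ ℂ^{n×m}, H ∈ ℂ^{m×n}, K ∈ ℂ^{m×m} form a minimal realization, i.e. rank[G, FG, F²G, …, F^{n−1}G] = n and rank[H; HF; HF²; …; HF^{n−1}] = n. Then the transfer function Γ(s) = H(sI − F)^{−1}G + K is lossless bounded real (i.e. F is Hurwitz and Γ(iω)†Γ(iω) = I_m for all ω ∈ ℝ) if and only if there exists a Hermitian positive-definite matrix X ∈ ℂ^{n×n} such that XF + F†X + H†H = 0, H†K = −XG, and K†K = I_m. -/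
open Matrix
open scoped ComplexOrder

noncomputable section

open Filter Topology in
theorem tendsto_mul_I_cobounded :
    Tendsto (fun ω : ℝ => (ω : ℂ) * Complex.I) atTop (Bornology.cobounded ℂ) := by
  rw [← tendsto_norm_atTop_iff_cobounded]
  simpa using tendsto_abs_atTop_atTop

section MatrixLemmas

variable {N M P Q : Type*} [Fintype N] [DecidableEq N] [Fintype M] [Fintype P] [DecidableEq P]

theorem mem_spectrum_iff_exists_mulVec_eq_smul {A : Matrix N N ℂ} {μ : ℂ} :
    μ ∈ spectrum ℂ A ↔ ∃ v ≠ 0, A *ᵥ v = μ • v := by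
  rw [spectrum.mem_iff, Matrix.isUnit_iff_isUnit_det, isUnit_iff_ne_zero, not_not,
    ← Matrix.exists_mulVec_eq_zero_iff]
  refine exists_congr fun v => and_congr_right fun _ => ?_
  rw [Matrix.sub_mulVec, sub_eq_zero, Algebra.algebraMap_eq_smul_one, Matrix.smul_mulVec,
    Matrix.one_mulVec, eq_comm]

theorem inv_smul_one_sub_eq_resolvent (F : Matrix N N ℂ) (s : ℂ) :
    (s • (1 : Matrix N N ℂ) - F)⁻¹ = resolvent F s := by
  rw [Matrix.nonsing_inv_eq_ringInverse, resolvent, Algebra.algebraMap_eq_smul_one]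

theorem IsHurwitz.isUnit {F : Matrix N N ℂ} (hF : IsHurwitz F) {s : ℂ} (hs : 0 ≤ s.re) :
    IsUnit (s • (1 : Matrix N N ℂ) - F) := by
  by_contra h
  rw [← Algebra.algebraMap_eq_smul_one, ← spectrum.mem_iff] at h
  exact (hF s h).not_ge hs

theorem mem_spectrum_neg_conjTranspose {F : Matrix N N ℂ} {μ : ℂ}
    (h : μ ∈ spectrum ℂ (-Fᴴ)) : -star μ ∈ spectrum ℂ F := by
  rw [← spectrum.neg_eq, Set.mem_neg, ← Matrix.star_eq_conjTranspose, spectrum.map_star,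
    Set.mem_star, star_neg] at h
  exact h

theorem IsHurwitz.isUnit_neg_conjTranspose {F : Matrix N N ℂ} (hF : IsHurwitz F) {s : ℂ}
    (hs : s.re ≤ 0) : IsUnit (s • (1 : Matrix N N ℂ) - -Fᴴ) := by
  by_contra h
  rw [← Algebra.algebraMap_eq_smul_one, ← spectrum.mem_iff] at h
  have := hF _ (mem_spectrum_neg_conjTranspose h)
  simp at this
  linarith

omit [Fintype M] in
theorem smul_mul_inv_smul_one_sub_mul {A : Matrix N N ℂ} {s : ℂ}
    (h : IsUnit (s • (1 : Matrix N N ℂ) - A)) (C : Matrix M N ℂ) (B : Matrix N Q ℂ) :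
    s • (C * (s • (1 : Matrix N N ℂ) - A)⁻¹ * B) =
      C * B + C * A * (s • (1 : Matrix N N ℂ) - A)⁻¹ * B := by
  have h1 := Matrix.mul_nonsing_inv _ ((Matrix.isUnit_iff_isUnit_det _).1 h)
  rw [Matrix.sub_mul, Matrix.smul_mul, Matrix.one_mul, sub_eq_iff_eq_add] at h1
  rw [← Matrix.smul_mul, ← Matrix.mul_smul, h1]
  simp only [Matrix.mul_add, Matrix.add_mul, Matrix.mul_one, Matrix.mul_assoc]

section Normed

open Filter Topology
open scoped Matrix.Norms.Operator

theorem tendsto_inv_smul_one_sub (F : Matrix N N ℂ) :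
    Tendsto (fun ω : ℝ => (((ω : ℂ) * Complex.I) • (1 : Matrix N N ℂ) - F)⁻¹) atTop (𝓝 0) := by
  simp_rw [inv_smul_one_sub_eq_resolvent]
  exact (spectrum.resolvent_tendsto_cobounded F).comp tendsto_mul_I_cobounded

theorem tendsto_pow_of_spectrum_norm_lt_one {A : Matrix N N ℂ}
    (hA : ∀ μ ∈ spectrum ℂ A, ‖μ‖ < 1) : Tendsto (fun k : ℕ => A ^ k) atTop (𝓝 0) := by
  cases isEmpty_or_nonempty N
  · exact tendsto_const_nhds.congr fun k => Subsingleton.elim _ _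
  have hr : spectralRadius ℂ A < 1 := by
    have := spectrum.spectralRadius_lt_of_forall_lt A (r := 1) fun z hz => by
      exact_mod_cast hA z hz
    simpa using this
  obtain ⟨r, hAr, hr1⟩ := ENNReal.lt_iff_exists_nnreal_btwn.1 hr
  have hr1 : r < 1 := by exact_mod_cast hr1
  have hev :=
    (spectrum.pow_nnnorm_pow_one_div_tendsto_nhds_spectralRadius A).eventually_lt_const hAr
  refine squeeze_zero_norm' (a := fun k => (r : ℝ) ^ k) ?_
    (tendsto_pow_atTop_nhds_zero_of_lt_one r.2 (by exact_mod_cast hr1))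
  filter_upwards [hev, eventually_gt_atTop 0] with k hk hk0
  have hk' : (0 : ℝ) < k := by exact_mod_cast hk0
  rw [one_div, ENNReal.rpow_inv_lt_iff hk', ENNReal.rpow_natCast] at hk
  exact_mod_cast hk.le

theorem tendsto_conjTranspose_pow_mul_mul_pow {A : Matrix N N ℂ}
    (hA : Tendsto (fun k : ℕ => A ^ k) atTop (𝓝 0)) (X : Matrix N N ℂ) :
    Tendsto (fun k : ℕ => (A ^ k)ᴴ * X * A ^ k) atTop (𝓝 0) := by
  have h : Continuous fun B : Matrix N N ℂ => Bᴴ * X * B := by fun_prop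
  simpa [Function.comp_def] using (h.tendsto 0).comp hA

theorem eq_zero_of_eq_conjTranspose_mul_mul {A X : Matrix N N ℂ}
    (hA : Tendsto (fun k : ℕ => A ^ k) atTop (𝓝 0)) (hX : X = Aᴴ * X * A) : X = 0 := by
  have h : ∀ k : ℕ, (A ^ k)ᴴ * X * A ^ k = X := by
    intro k
    induction k with
    | zero => simp
    | succ k ih =>
      calc (A ^ (k + 1))ᴴ * X * A ^ (k + 1) = (A ^ k)ᴴ * (Aᴴ * X * A) * A ^ k := by
            rw [pow_succ', Matrix.conjTranspose_mul]; simp only [Matrix.mul_assoc]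
        _ = X := by rw [← hX, ih]
  have := tendsto_conjTranspose_pow_mul_mul_pow hA X
  simp_rw [h] at this
  exact tendsto_nhds_unique tendsto_const_nhds this

theorem posSemidef_of_sub_conjTranspose_mul_mul {A X : Matrix N N ℂ}
    (hA : Tendsto (fun k : ℕ => A ^ k) atTop (𝓝 0)) (hX : X.IsHermitian)
    (hQ : (X - Aᴴ * X * A).PosSemidef) : X.PosSemidef := by
  have h : ∀ k : ℕ, (X - (A ^ k)ᴴ * X * A ^ k).PosSemidef := by
    intro k
    induction k with
    | zero => simpa using Matrix.PosSemidef.zero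
    | succ k ih =>
      have : X - (A ^ (k + 1))ᴴ * X * A ^ (k + 1) =
          (X - (A ^ k)ᴴ * X * A ^ k) + (A ^ k)ᴴ * (X - Aᴴ * X * A) * A ^ k := by
        rw [pow_succ', Matrix.conjTranspose_mul]
        simp only [Matrix.mul_assoc, Matrix.mul_sub, Matrix.sub_mul]
        abel
      rw [this]
      exact ih.add (hQ.conjTranspose_mul_mul_same _)
  refine Matrix.PosSemidef.of_dotProduct_mulVec_nonneg hX fun v => ?_
  have hc : Continuous fun B : Matrix N N ℂ => star v ⬝ᵥ ((X - B) *ᵥ v) := by fun_prop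
  have ht := (hc.tendsto 0).comp (tendsto_conjTranspose_pow_mul_mul_pow hA X)
  rw [sub_zero] at ht
  exact ge_of_tendsto' ht fun k => (h k).dotProduct_mulVec_nonneg v

omit [Fintype M] in
theorem mul_pow_mul_eq_of_resolvent_eq {A : Matrix N N ℂ} {D : Matrix P P ℂ}
    (hA : ∀ ω : ℝ, IsUnit (((ω : ℂ) * Complex.I) • (1 : Matrix N N ℂ) - A))
    (hD : ∀ ω : ℝ, IsUnit (((ω : ℂ) * Complex.I) • (1 : Matrix P P ℂ) - D))
    {B : Matrix N Q ℂ} {E : Matrix P Q ℂ} (k : ℕ) : ∀ {C : Matrix M N ℂ} {J : Matrix M P ℂ},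
    (∀ ω : ℝ, C * (((ω : ℂ) * Complex.I) • (1 : Matrix N N ℂ) - A)⁻¹ * B =
      J * (((ω : ℂ) * Complex.I) • (1 : Matrix P P ℂ) - D)⁻¹ * E) →
    C * A ^ k * B = J * D ^ k * E := by
  have key : ∀ {C : Matrix M N ℂ} {J : Matrix M P ℂ},
      (∀ ω : ℝ, C * (((ω : ℂ) * Complex.I) • (1 : Matrix N N ℂ) - A)⁻¹ * B =
        J * (((ω : ℂ) * Complex.I) • (1 : Matrix P P ℂ) - D)⁻¹ * E) → C * B = J * E := by
    intro C J h
    have hs : ∀ ω : ℝ, C * B + C * A * (((ω : ℂ) * Complex.I) • (1 : Matrix N N ℂ) - A)⁻¹ * B =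
        J * E + J * D * (((ω : ℂ) * Complex.I) • (1 : Matrix P P ℂ) - D)⁻¹ * E := fun ω => by
      rw [← smul_mul_inv_smul_one_sub_mul (hA ω), ← smul_mul_inv_smul_one_sub_mul (hD ω), h]
    have c1 : Continuous fun R : Matrix N N ℂ => C * B + C * A * R * B := by fun_prop
    have c2 : Continuous fun R : Matrix P P ℂ => J * E + J * D * R * E := by fun_prop
    have t1 := (c1.tendsto 0).comp (tendsto_inv_smul_one_sub A)
    have t2 := (c2.tendsto 0).comp (tendsto_inv_smul_one_sub D)
    simpa using tendsto_nhds_unique (t1.congr hs) t2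
  induction k with
  | zero => intro C J h; simpa using key h
  | succ k ih =>
    intro C J h
    rw [pow_succ', pow_succ', ← Matrix.mul_assoc, ← Matrix.mul_assoc]
    refine ih fun ω => ?_
    have := smul_mul_inv_smul_one_sub_mul (hA ω) C B
    rw [h, smul_mul_inv_smul_one_sub_mul (hD ω), key h] at this
    exact (add_left_cancel this).symm

theorem IsHurwitz.exists_cayley {F : Matrix N N ℂ} (hF : IsHurwitz F) :
    ∃ A R : Matrix N N ℂ, Tendsto (fun k : ℕ => A ^ k) atTop (𝓝 0) ∧
      ∀ X : Matrix N N ℂ, X - Aᴴ * X * A = Rᴴ * ((-2 : ℂ) • (X * F + Fᴴ * X)) * R := by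
  have hu : IsUnit (1 - F) := by simpa using hF.isUnit (s := 1) (by simp)
  have hd := (Matrix.isUnit_iff_isUnit_det _).1 hu
  set R := (1 - F)⁻¹ with hR
  have h1 : (1 - F) * R = 1 := Matrix.mul_nonsing_inv _ hd
  refine ⟨(1 + F) * R, R, ?_, fun X => ?_⟩
  · refine tendsto_pow_of_spectrum_norm_lt_one fun μ hμ => ?_
    obtain ⟨v, hv, hμv⟩ := mem_spectrum_iff_exists_mulVec_eq_smul.1 hμ
    set w := R *ᵥ v with hw
    have hvw : v = w - F *ᵥ w := by
      rw [← Matrix.one_mulVec v, ← h1, ← Matrix.mulVec_mulVec, ← hw, Matrix.sub_mulVec,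
        Matrix.one_mulVec]
    have hw0 : w ≠ 0 := by
      intro h0
      apply hv
      rw [hvw, h0]
      simp
    rw [← Matrix.mulVec_mulVec, ← hw, Matrix.add_mulVec, Matrix.one_mulVec, hvw] at hμv
    have hFw : (1 + μ) • F *ᵥ w = (μ - 1) • w := by
      have : (1 + μ) • F *ᵥ w - (μ - 1) • w = (w + F *ᵥ w) - μ • (w - F *ᵥ w) := by module
      rwa [← sub_eq_zero, this, sub_eq_zero]
    have hμ1 : 1 + μ ≠ 0 := by
      intro h0
      have : μ = -1 := by linear_combination h0
      subst this
      rw [h0, zero_smul, eq_comm, smul_eq_zero] at hFw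
      exact hFw.elim (by norm_num) hw0
    have hmem : (1 + μ)⁻¹ * (μ - 1) ∈ spectrum ℂ F :=
      mem_spectrum_iff_exists_mulVec_eq_smul.2 ⟨w, hw0, by
        rw [mul_smul, ← hFw, smul_smul, inv_mul_cancel₀ hμ1, one_smul]⟩
    have hre := hF _ hmem
    have hn : 0 < Complex.normSq (1 + μ) := Complex.normSq_pos.2 hμ1
    have hre' : ((1 + μ)⁻¹ * (μ - 1)).re = (‖μ‖ ^ 2 - 1) / Complex.normSq (1 + μ) := by
      rw [← Complex.normSq_eq_norm_sq, Complex.mul_re, Complex.inv_re, Complex.inv_im,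
        Complex.normSq_apply μ]
      simp
      ring
    rw [hre', div_neg_iff] at hre
    have : ‖μ‖ ^ 2 < 1 := by
      rcases hre with h | h <;> linarith
    nlinarith [norm_nonneg μ]
  · have h2 : Rᴴ * (1 - F)ᴴ = 1 := by
      rw [← Matrix.conjTranspose_mul, h1, Matrix.conjTranspose_one]
    have h3 : X = Rᴴ * ((1 - F)ᴴ * X * (1 - F)) * R := by
      calc X = (Rᴴ * (1 - F)ᴴ) * X * ((1 - F) * R) := by rw [h1, h2]; simp
        _ = _ := by simp only [Matrix.mul_assoc]
    have h4 : ((1 + F) * R)ᴴ * X * ((1 + F) * R) = Rᴴ * ((1 + F)ᴴ * X * (1 + F)) * R := by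
      rw [Matrix.conjTranspose_mul]; simp only [Matrix.mul_assoc]
    rw [h4]
    nth_rewrite 1 [h3]
    rw [← Matrix.sub_mul, ← Matrix.mul_sub]
    congr 2
    simp only [Matrix.conjTranspose_sub, Matrix.conjTranspose_add, Matrix.conjTranspose_one]
    rw [neg_smul, two_smul]
    noncomm_ring

end Normed

theorem IsHurwitz.existsUnique_lyapunov {F : Matrix N N ℂ} (hF : IsHurwitz F) (Q : Matrix N N ℂ) :
    ∃! X : Matrix N N ℂ, X * F + Fᴴ * X = Q := by
  obtain ⟨A, R, hA, hX⟩ := hF.exists_cayley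
  let L : Matrix N N ℂ →ₗ[ℂ] Matrix N N ℂ :=
    LinearMap.mulRight ℂ F + LinearMap.mulLeft ℂ Fᴴ
  have hL : ∀ X, L X = X * F + Fᴴ * X := fun X => rfl
  have hinj : Function.Injective L := by
    rw [injective_iff_map_eq_zero]
    intro X h
    rw [hL] at h
    refine eq_zero_of_eq_conjTranspose_mul_mul hA ?_
    have := hX X
    rwa [h, smul_zero, Matrix.mul_zero, Matrix.zero_mul, sub_eq_zero] at this
  exact Function.Bijective.existsUnique ⟨hinj, LinearMap.injective_iff_surjective.1 hinj⟩ Q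

theorem IsHurwitz.posSemidef_of_lyapunov {F X Q : Matrix N N ℂ} (hF : IsHurwitz F)
    (hX : X.IsHermitian) (hQ : Q.PosSemidef) (h : X * F + Fᴴ * X + Q = 0) : X.PosSemidef := by
  obtain ⟨A, R, hA, hXA⟩ := hF.exists_cayley
  refine posSemidef_of_sub_conjTranspose_mul_mul hA hX ?_
  rw [hXA, eq_neg_of_add_eq_zero_left h, smul_neg, neg_smul, neg_neg]
  exact (hQ.smul (by norm_num)).conjTranspose_mul_mul_same _

omit [DecidableEq N] in
theorem star_dotProduct_conjTranspose_mul_self_mulVec_eq_zero {H : Matrix M N ℂ} {v : N → ℂ}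
    (h : star v ⬝ᵥ ((Hᴴ * H) *ᵥ v) = 0) : H *ᵥ v = 0 := by
  rwa [← Matrix.mulVec_mulVec, Matrix.dotProduct_mulVec, ← Matrix.star_mulVec,
    dotProduct_star_self_eq_zero] at h

/-- For a Hurwitz `F` and an observable pair `(H, F)`, the Lyapunov equation has a positive
definite solution. -/
theorem IsHurwitz.exists_posDef_lyapunov {F : Matrix N N ℂ} {H : Matrix M N ℂ} (hF : IsHurwitz F)
    (hobs : ∀ v, (∀ k : ℕ, H *ᵥ (F ^ k *ᵥ v) = 0) → v = 0) :
    ∃ X : Matrix N N ℂ, X.PosDef ∧ X * F + Fᴴ * X + Hᴴ * H = 0 := by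
  obtain ⟨X, hX, huniq⟩ := hF.existsUnique_lyapunov (-(Hᴴ * H))
  have hX0 : X * F + Fᴴ * X + Hᴴ * H = 0 := by rw [hX, neg_add_cancel]
  have hherm : Xᴴ = X := by
    refine huniq Xᴴ ?_
    have := congrArg Matrix.conjTranspose hX
    simpa [Matrix.conjTranspose_mul, add_comm] using this
  have hpsd := hF.posSemidef_of_lyapunov hherm (Matrix.posSemidef_conjTranspose_mul_self H) hX0
  refine ⟨X, ?_, hX0⟩
  have hker : ∀ v, X *ᵥ v = 0 → H *ᵥ v = 0 ∧ X *ᵥ (F *ᵥ v) = 0 := by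
    intro v hv
    have h1 : X *ᵥ (F *ᵥ v) + Hᴴ *ᵥ (H *ᵥ v) = 0 := by
      have := congrArg (· *ᵥ v) hX0
      simpa [Matrix.add_mulVec, ← Matrix.mulVec_mulVec, hv] using this
    have h2 : star v ⬝ᵥ (X *ᵥ (F *ᵥ v)) = 0 := by
      rw [Matrix.dotProduct_mulVec, ← hherm, ← Matrix.star_mulVec, hv]
      simp
    have h3 : H *ᵥ v = 0 := by
      refine star_dotProduct_conjTranspose_mul_self_mulVec_eq_zero ?_
      have := congrArg (star v ⬝ᵥ ·) h1
      rwa [dotProduct_add, h2, zero_add, dotProduct_zero, Matrix.mulVec_mulVec] at this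
    exact ⟨h3, by simpa [h3] using h1⟩
  refine Matrix.PosDef.of_dotProduct_mulVec_pos hherm fun v hv => ?_
  refine lt_of_le_of_ne (hpsd.dotProduct_mulVec_nonneg v) fun h0 => hv ?_
  have hv0 : X *ᵥ v = 0 := (hpsd.dotProduct_mulVec_zero_iff v).1 h0.symm
  have hpow : ∀ k : ℕ, X *ᵥ (F ^ k *ᵥ v) = 0 := by
    intro k
    induction k with
    | zero => simpa using hv0
    | succ k ih =>
      rw [pow_succ', ← Matrix.mulVec_mulVec]
      exact (hker _ ih).2
  exact hobs v fun k => (hker _ (hpow k)).1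

theorem isHurwitz_of_posDef_lyapunov {F X : Matrix N N ℂ} {H : Matrix M N ℂ} (hX : X.PosDef)
    (h : X * F + Fᴴ * X + Hᴴ * H = 0)
    (hobs : ∀ v, (∀ k : ℕ, H *ᵥ (F ^ k *ᵥ v) = 0) → v = 0) : IsHurwitz F := by
  intro μ hμ
  obtain ⟨v, hv, hμv⟩ := mem_spectrum_iff_exists_mulVec_eq_smul.1 hμ
  by_contra! hre
  have hq : star v ⬝ᵥ ((Hᴴ * H) *ᵥ v) = -((μ + star μ) * (star v ⬝ᵥ (X *ᵥ v))) := by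
    have h1 := congrArg (fun B => star v ⬝ᵥ (B *ᵥ v)) h
    simp only [Matrix.add_mulVec, dotProduct_add, Matrix.zero_mulVec, dotProduct_zero] at h1
    have h2 : star v ⬝ᵥ ((X * F) *ᵥ v) = μ * (star v ⬝ᵥ (X *ᵥ v)) := by
      rw [← Matrix.mulVec_mulVec, hμv, Matrix.mulVec_smul, dotProduct_smul, smul_eq_mul]
    have h3 : star v ⬝ᵥ ((Fᴴ * X) *ᵥ v) = star μ * (star v ⬝ᵥ (X *ᵥ v)) := by
      rw [← Matrix.mulVec_mulVec, Matrix.dotProduct_mulVec, ← Matrix.star_mulVec, hμv, star_smul,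
        smul_dotProduct, smul_eq_mul]
    linear_combination h1 - h2 - h3
  have hH : H *ᵥ v = 0 := by
    refine star_dotProduct_conjTranspose_mul_self_mulVec_eq_zero (le_antisymm ?_ ?_)
    · rw [hq, neg_nonpos]
      refine mul_nonneg ?_ (hX.posSemidef.dotProduct_mulVec_nonneg v)
      have : μ + star μ = ((2 * μ.re : ℝ) : ℂ) := by simpa using Complex.add_conj μ
      rw [this]
      exact_mod_cast (by linarith : (0 : ℝ) ≤ 2 * μ.re)
    · exact (Matrix.posSemidef_conjTranspose_mul_self H).dotProduct_mulVec_nonneg v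
  refine hv (hobs v fun k => ?_)
  have hk : F ^ k *ᵥ v = μ ^ k • v := by
    induction k with
    | zero => simp
    | succ k ih =>
      rw [pow_succ, ← Matrix.mulVec_mulVec, hμv, Matrix.mulVec_smul, ih, smul_smul, pow_succ']
  rw [hk, Matrix.mulVec_smul, hH, smul_zero]

omit [DecidableEq N] [Fintype M] in
theorem mulVec_eq_zero_of_rank_eq_card {A : Matrix M N ℂ} (hA : A.rank = Fintype.card N)
    {v : N → ℂ} (hv : A *ᵥ v = 0) : v = 0 := by
  have h := LinearMap.finrank_range_add_finrank_ker A.mulVecLin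
  rw [← Matrix.rank, hA, Module.finrank_fintype_fun_eq_card, Nat.add_eq_left,
    Submodule.finrank_eq_zero] at h
  exact (Submodule.mem_bot ℂ).1 (h ▸ (by simpa using hv : v ∈ LinearMap.ker A.mulVecLin))

omit [Fintype M] in
theorem eq_zero_of_rank_obsvMat {F : Matrix N N ℂ} {H : Matrix M N ℂ} {k : ℕ}
    (hr : (obsvMat F H k).rank = Fintype.card N) (v : N → ℂ)
    (hv : ∀ j : ℕ, H *ᵥ (F ^ j *ᵥ v) = 0) : v = 0 := by
  refine mulVec_eq_zero_of_rank_eq_card hr (funext fun p => ?_)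
  have := congrFun (hv p.1) p.2
  rwa [Matrix.mulVec_mulVec] at this

omit [Fintype M] in
theorem conjTranspose_ctrbMat (F : Matrix N N ℂ) (G : Matrix N M ℂ) (k : ℕ) :
    (ctrbMat F G k)ᴴ = obsvMat Fᴴ Gᴴ k := by
  ext p j
  simp [ctrbMat, obsvMat, ← Matrix.conjTranspose_pow, ← Matrix.conjTranspose_mul,
    Matrix.conjTranspose_apply]

end MatrixLemmas

section Lossless

variable {N M : Type*} [Fintype N] [DecidableEq N] [Fintype M] [DecidableEq M]
  {F X : Matrix N N ℂ} {G : Matrix N M ℂ} {H : Matrix M N ℂ} {K : Matrix M M ℂ}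

omit [DecidableEq M] in
theorem conjTranspose_transferFn_mul_self (hX : X.IsHermitian)
    (h : X * F + Fᴴ * X + Hᴴ * H = 0) {s : ℂ} (hs : star s = -s)
    (hu : IsUnit (s • (1 : Matrix N N ℂ) - F)) :
    (transferFn F G H K s)ᴴ * transferFn F G H K s = Kᴴ * K +
      (Hᴴ * K + X * G)ᴴ * (s • (1 : Matrix N N ℂ) - F)⁻¹ * G +
      Gᴴ * ((s • (1 : Matrix N N ℂ) - F)⁻¹)ᴴ * (Hᴴ * K + X * G) := by
  set S := s • (1 : Matrix N N ℂ) - F with hS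
  set R := S⁻¹ with hR
  have h1 : S * R = 1 := Matrix.mul_nonsing_inv _ ((Matrix.isUnit_iff_isUnit_det _).1 hu)
  have h2 : Rᴴ * Sᴴ = 1 := by rw [← Matrix.conjTranspose_mul, h1, Matrix.conjTranspose_one]
  have hHH : Hᴴ * H = X * S + Sᴴ * X := by
    rw [eq_neg_of_add_eq_zero_right h, hS]
    simp [Matrix.mul_sub, Matrix.sub_mul, hs]
    abel
  have hmid : Rᴴ * Hᴴ * H * R = Rᴴ * X + X * R := by
    calc Rᴴ * Hᴴ * H * R = Rᴴ * (Hᴴ * H) * R := by simp only [Matrix.mul_assoc]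
      _ = Rᴴ * X * (S * R) + (Rᴴ * Sᴴ) * X * R := by
        rw [hHH]; simp only [Matrix.mul_add, Matrix.add_mul, Matrix.mul_assoc]
      _ = _ := by rw [h1, h2]; simp
  have hmid' : Gᴴ * (Rᴴ * Hᴴ * H * R) * G = Gᴴ * (Rᴴ * X + X * R) * G := by rw [hmid]
  simp only [transferFn, ← hS, ← hR, Matrix.conjTranspose_add, Matrix.conjTranspose_mul,
    Matrix.conjTranspose_conjTranspose, hX.eq, Matrix.mul_add, Matrix.add_mul,
    Matrix.mul_assoc] at hmid' ⊢
  rw [hmid']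
  abel

theorem losslessBoundedReal_of_posDef (hX : X.PosDef) (h : X * F + Fᴴ * X + Hᴴ * H = 0)
    (hHK : Hᴴ * K = -(X * G)) (hK : Kᴴ * K = 1)
    (hobs : ∀ v, (∀ k : ℕ, H *ᵥ (F ^ k *ᵥ v) = 0) → v = 0) : LosslessBoundedReal F G H K := by
  have hF := isHurwitz_of_posDef_lyapunov hX h hobs
  refine ⟨hF, fun ω => ?_⟩
  rw [conjTranspose_transferFn_mul_self hX.isHermitian h (by simp) (hF.isUnit (by simp)), hHK, hK]
  simp

open Filter Topology in
theorem LosslessBoundedReal.conjTranspose_mul_self (hl : LosslessBoundedReal F G H K) :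
    Kᴴ * K = 1 := by
  have hc : Continuous fun R : Matrix N N ℂ => (H * R * G + K)ᴴ * (H * R * G + K) := by fun_prop
  have ht := (hc.tendsto 0).comp (tendsto_inv_smul_one_sub F)
  have := tendsto_nhds_unique (ht.congr hl.2) tendsto_const_nhds
  simpa using this

theorem IsHurwitz.isUnit_aeval_charpoly_neg_conjTranspose (hF : IsHurwitz F) :
    IsUnit (Polynomial.aeval F (-Fᴴ).charpoly) := by
  cases isEmpty_or_nonempty N
  · exact isUnit_of_subsingleton _
  by_contra h
  rw [← spectrum.zero_mem_iff ℂ,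
    spectrum.map_polynomial_aeval_of_nonempty _ _
      (spectrum.nonempty_of_isAlgClosed_of_finiteDimensional ℂ F)] at h
  obtain ⟨μ, hμ, h0⟩ := h
  have h1 := mem_spectrum_neg_conjTranspose (Matrix.mem_spectrum_iff_isRoot_charpoly.2 h0)
  have h2 := hF _ hμ
  have h3 := hF _ h1
  simp at h3
  linarith

omit [Fintype M] [DecidableEq M] in
theorem mul_aeval_mul_eq_of_mul_pow_mul_eq {A D : Matrix N N ℂ} {C J : Matrix M N ℂ}
    {B E : Matrix N M ℂ} (h : ∀ k : ℕ, C * A ^ k * B = J * D ^ k * E) (p : Polynomial ℂ) :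
    C * Polynomial.aeval A p * B = J * Polynomial.aeval D p * E := by
  simp only [Polynomial.aeval_eq_sum_range, Matrix.mul_sum, Matrix.sum_mul, Matrix.mul_smul,
    Matrix.smul_mul, h]

theorem LosslessBoundedReal.conjTranspose_mul_add_eq_zero (hl : LosslessBoundedReal F G H K)
    (hX : X.IsHermitian) (h : X * F + Fᴴ * X + Hᴴ * H = 0)
    (hctr : ∀ v, (∀ k : ℕ, Gᴴ *ᵥ (Fᴴ ^ k *ᵥ v) = 0) → v = 0) : Hᴴ * K + X * G = 0 := by
  have hF := hl.1
  set L := Hᴴ * K + X * G with hL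
  have hres : ∀ ω : ℝ, Lᴴ * (((ω : ℂ) * Complex.I) • (1 : Matrix N N ℂ) - F)⁻¹ * G =
      Gᴴ * (((ω : ℂ) * Complex.I) • (1 : Matrix N N ℂ) - -Fᴴ)⁻¹ * L := by
    intro ω
    have h1 := conjTranspose_transferFn_mul_self (G := G) (K := K) hX h
      (s := (ω : ℂ) * Complex.I) (by simp) (hF.isUnit (by simp))
    have h2 : ((((ω : ℂ) * Complex.I) • (1 : Matrix N N ℂ) - F)⁻¹)ᴴ =
        -(((ω : ℂ) * Complex.I) • (1 : Matrix N N ℂ) - -Fᴴ)⁻¹ := by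
      rw [Matrix.conjTranspose_nonsing_inv, show
        (((ω : ℂ) * Complex.I) • (1 : Matrix N N ℂ) - F)ᴴ =
          -(((ω : ℂ) * Complex.I) • (1 : Matrix N N ℂ) - -Fᴴ) by simp; abel]
      refine Matrix.inv_eq_left_inv ?_
      rw [neg_mul_neg, Matrix.nonsing_inv_mul _ ((Matrix.isUnit_iff_isUnit_det _).1
        (hF.isUnit_neg_conjTranspose (by simp)))]
    rw [hl.2, hl.conjTranspose_mul_self, h2, add_assoc, left_eq_add, ← hL, Matrix.mul_neg,
      Matrix.neg_mul, add_neg_eq_zero] at h1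
    exact h1
  have hmarkov := fun k => mul_pow_mul_eq_of_resolvent_eq (fun ω => hF.isUnit (by simp))
    (fun ω => hF.isUnit_neg_conjTranspose (by simp)) k hres
  set χ := (-Fᴴ).charpoly
  have hz : ∀ k : ℕ, Lᴴ * Polynomial.aeval F χ * F ^ k * G = 0 := by
    intro k
    have := mul_aeval_mul_eq_of_mul_pow_mul_eq hmarkov (χ * Polynomial.X ^ k)
    simpa [Matrix.aeval_self_charpoly, χ, Matrix.mul_assoc] using this
  have hW : (Lᴴ * Polynomial.aeval F χ)ᴴ = 0 := by
    refine Matrix.ext_of_mulVec_single fun j => ?_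
    rw [Matrix.zero_mulVec]
    refine hctr _ fun k => ?_
    have := congrArg Matrix.conjTranspose (hz k)
    rw [Matrix.conjTranspose_mul, Matrix.conjTranspose_mul _ (F ^ k),
      Matrix.conjTranspose_pow, Matrix.conjTranspose_zero] at this
    rw [Matrix.mulVec_mulVec, Matrix.mulVec_mulVec, Matrix.mul_assoc, this, Matrix.zero_mulVec]
  rw [Matrix.conjTranspose_eq_zero] at hW
  obtain ⟨u, hu⟩ := hF.isUnit_aeval_charpoly_neg_conjTranspose
  rw [← Matrix.conjTranspose_eq_zero, ← Matrix.mul_one Lᴴ, ← u.mul_inv, hu, ← Matrix.mul_assoc, hW,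
    Matrix.zero_mul]

end Lossless

/-- Complex lossless bounded real lemma: for a minimal realization
`(F,G,H,K)`, the transfer function is lossless bounded real iff there exists a Hermitian
positive-definite `X` with `XF + F†X + H†H = 0`, `H†K = −XG` and `K†K = I`. -/
theorem stmt8 (n m : ℕ) (hn : 0 < n) (hm : 0 < m)
    (F : Matrix (Fin n) (Fin n) ℂ) (G : Matrix (Fin n) (Fin m) ℂ)
    (H : Matrix (Fin m) (Fin n) ℂ) (K : Matrix (Fin m) (Fin m) ℂ)
    (hctrb : (ctrbMat F G n).rank = n)
    (hobsv : (obsvMat F H n).rank = n) :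
    LosslessBoundedReal F G H K ↔
      ∃ X : Matrix (Fin n) (Fin n) ℂ, X.PosDef ∧
        X * F + Fᴴ * X + Hᴴ * H = 0 ∧
        Hᴴ * K = -(X * G) ∧
        Kᴴ * K = 1 := by
  have hobs := eq_zero_of_rank_obsvMat (hobsv.trans (Fintype.card_fin n).symm)
  have hctr := eq_zero_of_rank_obsvMat (F := Fᴴ) (H := Gᴴ) (k := n) (by
    rw [← conjTranspose_ctrbMat, Matrix.rank_conjTranspose, hctrb, Fintype.card_fin])
  constructor
  · intro hl
    obtain ⟨X, hX, h⟩ := hl.1.exists_posDef_lyapunov hobs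
    exact ⟨X, hX, h, eq_neg_of_add_eq_zero_left
      (hl.conjTranspose_mul_add_eq_zero hX.isHermitian h hctr), hl.conjTranspose_mul_self⟩
  · rintro ⟨X, hX, h, hHK, hK⟩
    exact losslessBoundedReal_of_posDef hX h hHK hK hobs
end
end

section
/- Real matrices A ∈ ℝ^{2n×2n}, B ∈ ℝ^{2n×2m}, C ∈ ℝ^{2m×2n}, D ∈ ℝ^{2m×2m} are physically realizable in the real quadrature sense if and only if there exists an invertible real skew-symmetric matrix Θ̃ ∈ ℝ^{2n×2n} (Θ̃^T = −Θ̃) such that: (1) AΘ̃ + Θ̃A^T + B J̃_m B^T = 0; (2) B = Θ̃ C^T J̃_m D; (3) D J̃_m D^T = J̃_m; and (4) D D^T = I_{2m}. -/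
open Matrix

noncomputable section

/-- `J̃_k = [[0, I],[−I, 0]]` as a real `2k × 2k` block matrix. -/
def Jt (k : ℕ) : Matrix (Fin k ⊕ Fin k) (Fin k ⊕ Fin k) ℝ :=
  Matrix.fromBlocks 0 1 (-1) 0

/-- Physical realizability in the real quadrature sense: there exist an invertible real
`S₀` with `Θ̃ := S₀ J̃_n S₀ᵀ`, a real symmetric `R` and a real `W` such that
`A = 2Θ̃R + (1/2)Θ̃Wᵀ J̃_m W`, `B = Θ̃Wᵀ J̃_m D`, `C = W`, `DDᵀ = I` and `D J̃_m Dᵀ = J̃_m`. -/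
def PhysRealQuad {n m : ℕ}
    (A : Matrix (Fin n ⊕ Fin n) (Fin n ⊕ Fin n) ℝ)
    (B : Matrix (Fin n ⊕ Fin n) (Fin m ⊕ Fin m) ℝ)
    (C : Matrix (Fin m ⊕ Fin m) (Fin n ⊕ Fin n) ℝ)
    (D : Matrix (Fin m ⊕ Fin m) (Fin m ⊕ Fin m) ℝ) : Prop :=
  ∃ (S₀ R : Matrix (Fin n ⊕ Fin n) (Fin n ⊕ Fin n) ℝ)
    (W : Matrix (Fin m ⊕ Fin m) (Fin n ⊕ Fin n) ℝ),
      IsUnit S₀ ∧ Rᵀ = R ∧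
      A = (2 : ℝ) • ((S₀ * Jt n * S₀ᵀ) * R) +
            (1 / 2 : ℝ) • ((S₀ * Jt n * S₀ᵀ) * Wᵀ * Jt m * W) ∧
      B = (S₀ * Jt n * S₀ᵀ) * Wᵀ * Jt m * D ∧
      C = W ∧
      D * Dᵀ = 1 ∧
      D * Jt m * Dᵀ = Jt m

/-- A nondegenerate alternating bilinear form admits symplectic families of any length `k` with
`2 * k ≤ dim V`. -/
theorem LinearMap.BilinForm.IsAlt.exists_symplectic_family {K V : Type*} [Field K]
    [AddCommGroup V] [Module K V] [FiniteDimensional K V] {ω : LinearMap.BilinForm K V}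
    (hω : ω.IsAlt) (hsep : ∀ v, (∀ w, ω v w = 0) → v = 0) (k : ℕ)
    (hk : 2 * k ≤ Module.finrank K V) :
    ∃ e f : Fin k → V, (∀ i j, ω (e i) (e j) = 0) ∧ (∀ i j, ω (f i) (f j) = 0) ∧
      ∀ i j, ω (e i) (f j) = if i = j then 1 else 0 := by
  induction k with
  | zero => exact ⟨Fin.elim0, Fin.elim0, by simp⟩
  | succ k ih =>
    obtain ⟨e, f, hee, hff, hef⟩ := ih (by omega)
    have hfe : ∀ i j, ω (f i) (e j) = if j = i then -1 else 0 := fun i j => by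
      rw [← hω.neg_eq, hef]; split_ifs <;> simp
    obtain ⟨P, hP⟩ : ∃ P : V → V,
        ∀ v, P v = v - ∑ i, ω v (f i) • e i + ∑ i, ω v (e i) • f i := ⟨_, fun _ => rfl⟩
    have hPe : ∀ v j, ω (P v) (e j) = 0 := fun v j => by
      simp [hP, LinearMap.sum_apply, hee, hfe]
    have hPf : ∀ v j, ω (P v) (f j) = 0 := fun v j => by
      simp [hP, LinearMap.sum_apply, hff, hef]
    have heP : ∀ v j, ω (e j) (P v) = 0 := fun v j => hω.isRefl _ _ (hPe v j)
    have hfP : ∀ v j, ω (f j) (P v) = 0 := fun v j => hω.isRefl _ _ (hPf v j)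
    obtain ⟨v, hv⟩ : ∃ v, v ∉ Submodule.span K (Set.range (Sum.elim e f)) := by
      by_contra! h
      have hle := finrank_range_le_card (R := K) (Sum.elim e f)
      rw [Set.finrank, (Submodule.eq_top_iff'.2 h), finrank_top] at hle
      simp at hle
      omega
    have hPv : P v ≠ 0 := fun h => hv <| by
      have hv' : v = ∑ i, ω v (f i) • e i - ∑ i, ω v (e i) • f i := by
        rw [hP, sub_add, sub_eq_zero] at h
        exact h
      rw [hv']
      exact Submodule.sub_mem _
        (Submodule.sum_mem _ fun i _ => Submodule.smul_mem _ _ (Submodule.subset_span ⟨.inl i, rfl⟩))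
        (Submodule.sum_mem _ fun i _ => Submodule.smul_mem _ _ (Submodule.subset_span ⟨.inr i, rfl⟩))
    obtain ⟨w, hw⟩ : ∃ w, ω (P v) w ≠ 0 := by
      by_contra! h
      exact hPv (hsep _ h)
    have hPw : ω (P v) (P w) = ω (P v) w := by
      rw [hP w]
      simp [hPe, hPf]
    refine ⟨Fin.cons (P v) e, Fin.cons ((ω (P v) w)⁻¹ • P w) f, ?_, ?_, ?_⟩
    · intro i j
      cases i using Fin.cases <;> cases j using Fin.cases <;>
        simp [hω.self_eq_zero, hPe, heP, hee]
    · intro i j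
      cases i using Fin.cases <;> cases j using Fin.cases <;>
        simp [hω.self_eq_zero, hPf, hfP, hff]
    · intro i j
      cases i using Fin.cases <;> cases j using Fin.cases <;>
        simp [hPw, hw, hPf, heP, hef, Fin.succ_ne_zero, (Fin.succ_ne_zero _).symm]

theorem Jt_transpose (k : ℕ) : (Jt k)ᵀ = -Jt k := by
  simp [Jt, fromBlocks_transpose, fromBlocks_neg]

theorem Jt_mul_Jt (k : ℕ) : Jt k * Jt k = -1 := by
  rw [Jt, fromBlocks_multiply, ← fromBlocks_one, fromBlocks_neg]
  simp

theorem isUnit_Jt (k : ℕ) : IsUnit (Jt k) :=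
  IsUnit.of_mul_eq_one (-Jt k) (by rw [mul_neg, Jt_mul_Jt, neg_neg])

/-- Every invertible real skew-symmetric matrix is congruent to the canonical one. -/
theorem exists_eq_mul_Jt_mul_transpose {n : ℕ} {Θ : Matrix (Fin n ⊕ Fin n) (Fin n ⊕ Fin n) ℝ}
    (hΘ : IsUnit Θ) (hskew : Θᵀ = -Θ) :
    ∃ S : Matrix (Fin n ⊕ Fin n) (Fin n ⊕ Fin n) ℝ, IsUnit S ∧ Θ = S * Jt n * Sᵀ := by
  have halt : (toBilin' Θ).IsAlt := fun v => by
    have h : v ⬝ᵥ Θ *ᵥ v = -(v ⬝ᵥ Θ *ᵥ v) := by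
      conv_lhs => rw [dotProduct_mulVec, ← mulVec_transpose, hskew, neg_mulVec, neg_dotProduct,
        dotProduct_comm]
    rw [toBilin'_apply']
    linarith
  have hnd : (toBilin' Θ).Nondegenerate :=
    LinearMap.BilinForm.nondegenerate_toBilin'_of_det_ne_zero' Θ
      ((isUnit_iff_isUnit_det Θ).1 hΘ).ne_zero
  obtain ⟨e, f, hee, hff, hef⟩ := halt.exists_symplectic_family hnd.1 n (by simp; omega)
  have hfe : ∀ i j, toBilin' Θ (f i) (e j) = if j = i then -1 else 0 := fun i j => by
    rw [← halt.neg_eq, hef]; split_ifs <;> simp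
  let M : Matrix (Fin n ⊕ Fin n) (Fin n ⊕ Fin n) ℝ := of (Sum.elim e f)
  have hM : M * Θ * Mᵀ = Jt n := by
    ext i j
    have h : (M * Θ * Mᵀ) i j = toBilin' Θ (Sum.elim e f i) (Sum.elim e f j) := by
      simp only [M, toBilin'_apply, mul_apply, transpose_apply, of_apply, Finset.sum_mul]
      exact Finset.sum_comm
    rw [h]
    rcases i with i | i <;> rcases j with j | j <;>
      simp only [Sum.elim_inl, Sum.elim_inr, hee, hff, hef, hfe] <;>
      simp [Jt, one_apply, eq_comm, neg_ite]
  have hMu : IsUnit M.det := by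
    have h := (isUnit_iff_isUnit_det _).1 (isUnit_Jt n)
    rw [← hM, det_mul, det_mul] at h
    exact isUnit_of_mul_isUnit_left (isUnit_of_mul_isUnit_left h)
  refine ⟨M⁻¹, (isUnit_iff_isUnit_det _).2 (isUnit_nonsing_inv_det _ hMu), ?_⟩
  rw [← hM, transpose_nonsing_inv, Matrix.mul_assoc M, nonsing_inv_mul_cancel_left _ _ hMu,
    mul_nonsing_inv_cancel_right _ _ (by rwa [det_transpose])]

/-- The input term of the commutation relation, expressed through the output matrix. -/
theorem mul_Jt_mul_transpose_of_eq {n m : ℕ} {Θ : Matrix (Fin n ⊕ Fin n) (Fin n ⊕ Fin n) ℝ}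
    {B : Matrix (Fin n ⊕ Fin n) (Fin m ⊕ Fin m) ℝ} {C : Matrix (Fin m ⊕ Fin m) (Fin n ⊕ Fin n) ℝ}
    {D : Matrix (Fin m ⊕ Fin m) (Fin m ⊕ Fin m) ℝ} (hskew : Θᵀ = -Θ)
    (hB : B = Θ * Cᵀ * Jt m * D) (hD : D * Jt m * Dᵀ = Jt m) :
    B * Jt m * Bᵀ = -(Θ * (Cᵀ * Jt m * C) * Θ) := by
  calc B * Jt m * Bᵀ
      = Θ * Cᵀ * Jt m * (D * Jt m * Dᵀ) * (Jt m)ᵀ * C * Θᵀ := by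
        rw [hB]; simp only [transpose_mul, transpose_transpose, Matrix.mul_assoc]
    _ = -(Θ * Cᵀ * (Jt m * Jt m) * -(Jt m) * C * Θ) := by
        rw [hD, hskew, Jt_transpose, Matrix.mul_neg]; simp only [Matrix.mul_assoc]
    _ = -(Θ * (Cᵀ * Jt m * C) * Θ) := by
        rw [Jt_mul_Jt]; simp [Matrix.mul_assoc]

/-- `(A,B,C,D)` is physically realizable in the real quadrature sense iff
there exists an invertible real skew-symmetric `Θ̃` with `AΘ̃ + Θ̃Aᵀ + B J̃_m Bᵀ = 0`,
`B = Θ̃Cᵀ J̃_m D`, `D J̃_m Dᵀ = J̃_m` and `DDᵀ = I`. -/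
theorem stmt11 (n m : ℕ) (hn : 0 < n) (hm : 0 < m)
    (A : Matrix (Fin n ⊕ Fin n) (Fin n ⊕ Fin n) ℝ)
    (B : Matrix (Fin n ⊕ Fin n) (Fin m ⊕ Fin m) ℝ)
    (C : Matrix (Fin m ⊕ Fin m) (Fin n ⊕ Fin n) ℝ)
    (D : Matrix (Fin m ⊕ Fin m) (Fin m ⊕ Fin m) ℝ) :
    PhysRealQuad A B C D ↔
      ∃ Θ : Matrix (Fin n ⊕ Fin n) (Fin n ⊕ Fin n) ℝ,
        IsUnit Θ ∧ Θᵀ = -Θ ∧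
        A * Θ + Θ * Aᵀ + B * Jt m * Bᵀ = 0 ∧
        B = Θ * Cᵀ * Jt m * D ∧
        D * Jt m * Dᵀ = Jt m ∧
        D * Dᵀ = 1 := by
  have hCJC : (Cᵀ * Jt m * C)ᵀ = -(Cᵀ * Jt m * C) := by
    simp [transpose_mul, Jt_transpose, Matrix.mul_assoc]
  constructor
  · rintro ⟨S, R, W, hS, hR, hA, hB, rfl, hDD, hDJ⟩
    have hskew : (S * Jt n * Sᵀ)ᵀ = -(S * Jt n * Sᵀ) := by
      simp [transpose_mul, Jt_transpose, Matrix.mul_assoc]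
    have hu : IsUnit (S * Jt n * Sᵀ) := (hS.mul (isUnit_Jt n)).mul ((isUnit_transpose S).2 hS)
    generalize S * Jt n * Sᵀ = Θ at *
    refine ⟨Θ, hu, hskew, ?_, hB, hDJ, hDD⟩
    rw [mul_Jt_mul_transpose_of_eq hskew hB hDJ]
    have hA' : A = Θ * ((2 : ℝ) • R + (1 / 2 : ℝ) • (Cᵀ * Jt m * C)) := by
      rw [hA]; simp [Matrix.mul_add, Matrix.mul_assoc]
    have hAt : Aᵀ = ((1 / 2 : ℝ) • (Cᵀ * Jt m * C) - (2 : ℝ) • R) * Θ := by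
      rw [hA', transpose_mul, transpose_add, transpose_smul, transpose_smul, hR, hCJC, hskew]
      rw [Matrix.mul_neg, ← Matrix.neg_mul]
      congr 1
      module
    rw [hAt, hA']
    simp only [← Matrix.mul_assoc, Matrix.mul_add, Matrix.add_mul, Matrix.mul_sub, Matrix.sub_mul,
      Matrix.mul_smul, Matrix.smul_mul]
    module
  · rintro ⟨Θ, hu, hskew, hcomm, hB, hDJ, hDD⟩
    have hdet := (isUnit_iff_isUnit_det Θ).1 hu
    obtain ⟨S, hS, hΘ⟩ := exists_eq_mul_Jt_mul_transpose hu hskew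
    rw [mul_Jt_mul_transpose_of_eq hskew hB hDJ] at hcomm
    have hinvskew : (Θ⁻¹)ᵀ = -Θ⁻¹ := by
      rw [transpose_nonsing_inv, hskew]
      exact inv_eq_right_inv (by simp [mul_nonsing_inv _ hdet])
    have hAt : Aᵀ * Θ⁻¹ = Cᵀ * Jt m * C - Θ⁻¹ * A := by
      have h := congrArg (fun X => Θ⁻¹ * X * Θ⁻¹) hcomm
      simp only [Matrix.mul_add, Matrix.add_mul, Matrix.mul_neg, Matrix.neg_mul, Matrix.mul_zero,
        Matrix.zero_mul] at h
      rw [← Matrix.mul_assoc Θ⁻¹ A, mul_nonsing_inv_cancel_right _ _ hdet,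
        nonsing_inv_mul_cancel_left _ _ hdet, Matrix.mul_assoc Θ (Cᵀ * Jt m * C) Θ,
        nonsing_inv_mul_cancel_left _ _ hdet, mul_nonsing_inv_cancel_right _ _ hdet] at h
      rw [← sub_eq_zero, ← h]
      abel
    refine ⟨S, (1 / 2 : ℝ) • (Θ⁻¹ * A - (1 / 2 : ℝ) • (Cᵀ * Jt m * C)), C, hS, ?_, ?_, ?_, rfl,
      hDD, hDJ⟩
    · rw [transpose_smul, transpose_sub, transpose_smul, hCJC, transpose_mul, hinvskew,
        Matrix.mul_neg, hAt]
      module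
    · rw [← hΘ, Matrix.mul_smul, Matrix.mul_sub, mul_nonsing_inv_cancel_left _ _ hdet,
        Matrix.mul_smul]
      simp only [Matrix.mul_assoc]
      module
    · rw [← hΘ]
      exact hB
end
end
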